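/- Let k : K → G and m : G → H be monos between monogamous acyclic hypergraphs, let y be an output of K and x an input of K. If there is a path in H from m(k(y)) to m(k(x)) that uses at least one hyperedge not in the image of m, then there exist an output y' of G and an input x' of G such that there is a path from k(y) to y' in G (or k(y) = y'), a path from m(y') to m(x') in H, and a path from x' to k(x) in G (or x' = k(x)). Consequently every path in H from m(k(y)) to m(k(x)) decomposes into a part inside the image of m∘k extended within m[G] to an output of G, a part of H witnessing (y',x') ∈ R_m, and a part within m[G] from an input of G. -/

import Mathlib

namespace HypRw

/-- A hypergraph over a signature `Sg` with arity `ar` and coarity `coar`: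
finite sets of nodes and hyperedges, source and target lists, and labels
compatible with arities. -/
structure Hypergraph (Sg : Type) (ar coar : Sg → ℕ) : Type 1 where
  V : Type
  E : Type
  fintV : Fintype V
  fintE : Fintype E
  label : E → Sg
  src : E → List V
  tgt : E → List V
  src_len : ∀ e, (src e).length = ar (label e)
  tgt_len : ∀ e, (tgt e).length = coar (label e)

attribute [instance] Hypergraph.fintV Hypergraph.fintE

variable {Sg : Type} {ar coar : Sg → ℕ}

/-- Morphisms of hypergraphs: functions on nodes and hyperedges preserving
sources, targets and labels. -/
structure Hom (G H : Hypergraph Sg ar coar) : Type where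
  onV : G.V → H.V
  onE : G.E → H.E
  label_eq : ∀ e, H.label (onE e) = G.label e
  src_eq : ∀ e, H.src (onE e) = (G.src e).map onV
  tgt_eq : ∀ e, H.tgt (onE e) = (G.tgt e).map onV

def Hom.comp {G H K : Hypergraph Sg ar coar} (g : Hom H K) (f : Hom G H) : Hom G K where
  onV := g.onV ∘ f.onV
  onE := g.onE ∘ f.onE
  label_eq e := by simp [Function.comp, g.label_eq, f.label_eq]
  src_eq e := by simp [Function.comp, g.src_eq, f.src_eq, List.map_map]
  tgt_eq e := by simp [Function.comp, g.tgt_eq, f.tgt_eq, List.map_map]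

def Hom.id (G : Hypergraph Sg ar coar) : Hom G G where
  onV := _root_.id
  onE := _root_.id
  label_eq e := rfl
  src_eq e := by simp
  tgt_eq e := by simp

/-- A morphism is mono iff it is injective on nodes and hyperedges. -/
def IsMono {G H : Hypergraph Sg ar coar} (f : Hom G H) : Prop :=
  Function.Injective f.onV ∧ Function.Injective f.onE

/-- In-degree of a node: the number of pairs (h,i) with `v` the i-th target of `h`. -/
noncomputable def Hypergraph.inDegree (G : Hypergraph Sg ar coar) (v : G.V) : ℕ :=
  letI := Classical.decEq G.V
  ∑ e : G.E, (G.tgt e).count v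

/-- Out-degree of a node: the number of pairs (h,i) with `v` the i-th source of `h`. -/
noncomputable def Hypergraph.outDegree (G : Hypergraph Sg ar coar) (v : G.V) : ℕ :=
  letI := Classical.decEq G.V
  ∑ e : G.E, (G.src e).count v

def Hypergraph.IsInput (G : Hypergraph Sg ar coar) (v : G.V) : Prop := G.inDegree v = 0
def Hypergraph.IsOutput (G : Hypergraph Sg ar coar) (v : G.V) : Prop := G.outDegree v = 0

/-- Two hyperedges are consecutive in a path when some target of the first is a
source of the second. -/
def EdgeStep (G : Hypergraph Sg ar coar) (e e' : G.E) : Prop :=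
  ∃ v, v ∈ G.tgt e ∧ v ∈ G.src e'

/-- `p` is a (directed) path in `G` from node `x` to node `y`. -/
def IsPathFromTo (G : Hypergraph Sg ar coar) (p : List G.E) (x y : G.V) : Prop :=
  ∃ hp : p ≠ [], List.Chain' (EdgeStep G) p ∧
    x ∈ G.src (p.head hp) ∧ y ∈ G.tgt (p.getLast hp)

def HasPath (G : Hypergraph Sg ar coar) (x y : G.V) : Prop :=
  ∃ p, IsPathFromTo G p x y

/-- `G` contains a (directed) cycle. -/
def Hypergraph.HasCycle (G : Hypergraph Sg ar coar) : Prop :=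
  ∃ (p : List G.E) (hp : p ≠ []), List.Chain' (EdgeStep G) p ∧
    EdgeStep G (p.getLast hp) (p.head hp)

/-- Every node has in-degree ≤ 1 and out-degree ≤ 1. -/
def Hypergraph.Monogamous (G : Hypergraph Sg ar coar) : Prop :=
  ∀ v, G.inDegree v ≤ 1 ∧ G.outDegree v ≤ 1

/-- Monogamous acyclic hypergraph. -/
def Hypergraph.IsMA (G : Hypergraph Sg ar coar) : Prop :=
  ¬ G.HasCycle ∧ G.Monogamous

/-- `m' : G → H'` path-covers `m : G → H` (written m ≲ m'): the path relation
`R_m ⊆ out(G) × in(G)` is contained in `R_{m'}`. -/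
def PathCovers {G H H' : Hypergraph Sg ar coar} (m : Hom G H) (m' : Hom G H') : Prop :=
  ∀ y x, G.IsOutput y → G.IsInput x →
    HasPath H (m.onV y) (m.onV x) → HasPath H' (m'.onV y) (m'.onV x)

/-- An ma-cospan `n → G ← m` (interfaces discrete): `G` is ma, the legs are
injective with images exactly the inputs resp. outputs of `G`. -/
def IsMACospan (G : Hypergraph Sg ar coar) {α β : Type}
    (i : α → G.V) (o : β → G.V) : Prop :=
  G.IsMA ∧ Function.Injective i ∧ Set.range i = {v | G.IsInput v} ∧
    Function.Injective o ∧ Set.range o = {v | G.IsOutput v}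

/-- Every input is connected by a path to every output. -/
def Hypergraph.StronglyConnected (G : Hypergraph Sg ar coar) : Prop :=
  ∀ x y, G.IsInput x → G.IsOutput y → HasPath G x y

/-- The discrete hypergraph on a finite set of nodes. -/
def Discrete (α : Type) [Fintype α] : Hypergraph Sg ar coar where
  V := α
  E := Empty
  fintV := inferInstance
  fintE := inferInstance
  label e := e.elim
  src e := e.elim
  tgt e := e.elim
  src_len e := e.elim
  tgt_len e := e.elim

/-- The hypergraph morphism from a discrete hypergraph induced by a function on nodes. -/
def discHom {α : Type} [Fintype α] (G : Hypergraph Sg ar coar) (f : α → G.V) :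
    Hom (Discrete α) G where
  onV := f
  onE e := e.elim
  label_eq e := e.elim
  src_eq e := e.elim
  tgt_eq e := e.elim

/-- Pushout square of hypergraphs (universal property). -/
def IsPushout {A B C D : Hypergraph Sg ar coar}
    (f : Hom A B) (g : Hom A C) (h : Hom B D) (k : Hom C D) : Prop :=
  h.comp f = k.comp g ∧
    ∀ (X : Hypergraph Sg ar coar) (u : Hom B X) (v : Hom C X),
      u.comp f = v.comp g → ∃! w : Hom D X, w.comp h = u ∧ w.comp k = v

/-- Pullback square of hypergraphs (universal property). -/
def IsPullback {A B C D : Hypergraph Sg ar coar}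
    (p : Hom A B) (q : Hom A C) (f : Hom B D) (g : Hom C D) : Prop :=
  f.comp p = g.comp q ∧
    ∀ (X : Hypergraph Sg ar coar) (u : Hom X B) (v : Hom X C),
      f.comp u = g.comp v → ∃! w : Hom X A, p.comp w = u ∧ q.comp w = v

/-- A convex match: a mono whose image is convex, i.e. every path in `G`
between two nodes of the image has all its hyperedges in the image. -/
def IsConvexMatch {L G : Hypergraph Sg ar coar} (f : Hom L G) : Prop :=
  IsMono f ∧
    ∀ (v v' : L.V) (p : List G.E) (hp : p ≠ []),
      List.Chain' (EdgeStep G) p →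
      f.onV v ∈ G.src (p.head hp) → f.onV v' ∈ G.tgt (p.getLast hp) →
      ∀ e ∈ p, ∃ e₀, f.onE e₀ = e

/-- An ma-rule `L ← i+j → R`: both `i → L ← j` and `i → R ← j` are ma-cospans. -/
structure MARule (Sg : Type) (ar coar : Sg → ℕ) : Type 1 where
  i : ℕ
  j : ℕ
  L : Hypergraph Sg ar coar
  R : Hypergraph Sg ar coar
  lhsIn : Fin i → L.V
  lhsOut : Fin j → L.V
  rhsIn : Fin i → R.V
  rhsOut : Fin j → R.V
  ma_lhs : IsMACospan L lhsIn lhsOut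
  ma_rhs : IsMACospan R rhsIn rhsOut

/-- A rule is left-linear when `i+j → L` is mono. -/
def MARule.IsLeftLinear (r : MARule Sg ar coar) : Prop :=
  Function.Injective (Sum.elim r.lhsIn r.lhsOut)

/-- A boundary complement of a mono `f : L → G` with respect to ma-cospans
`i → L ← j` and `n → G ← m`: a pushout complement `i+j → C → G` with
`i+j → C` mono, together with `d1, d2` making `j+n → C ← m+i` an ma-cospan. -/
structure BoundaryComplement {i j n m : ℕ} {L G : Hypergraph Sg ar coar}
    (a1 : Fin i → L.V) (a2 : Fin j → L.V) (b1 : Fin n → G.V) (b2 : Fin m → G.V)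
    (f : Hom L G) : Type 1 where
  C : Hypergraph Sg ar coar
  c1 : Fin i → C.V
  c2 : Fin j → C.V
  g : Hom C G
  po : IsPushout (discHom L (Sum.elim a1 a2)) (discHom C (Sum.elim c1 c2)) f g
  c_mono : Function.Injective (Sum.elim c1 c2)
  d1 : Fin n → C.V
  d2 : Fin m → C.V
  g_d1 : g.onV ∘ d1 = b1
  g_d2 : g.onV ∘ d2 = b2
  bc_ma : IsMACospan C (Sum.elim c2 d1) (Sum.elim d2 c1)

/-- The data of a convex DPO rewriting step `(D ← n+m) ⇝ (E ← n+m)` applying an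
ma-rule `r` at a convex match via a boundary complement. -/
structure StepData (r : MARule Sg ar coar) {n m : ℕ}
    (D : Hypergraph Sg ar coar) (dIn : Fin n → D.V) (dOut : Fin m → D.V)
    (E : Hypergraph Sg ar coar) (eIn : Fin n → E.V) (eOut : Fin m → E.V) : Type 1 where
  f : Hom r.L D
  C : Hypergraph Sg ar coar
  c1 : Fin r.i → C.V
  c2 : Fin r.j → C.V
  g : Hom C D
  h : Hom C E
  comatch : Hom r.R E
  d1 : Fin n → C.V
  d2 : Fin m → C.V
  maD : IsMACospan D dIn dOut
  maE : IsMACospan E eIn eOut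
  convex : IsConvexMatch f
  po_left : IsPushout (discHom r.L (Sum.elim r.lhsIn r.lhsOut))
    (discHom C (Sum.elim c1 c2)) f g
  c_mono : Function.Injective (Sum.elim c1 c2)
  g_d1 : g.onV ∘ d1 = dIn
  g_d2 : g.onV ∘ d2 = dOut
  bc_ma : IsMACospan C (Sum.elim c2 d1) (Sum.elim d2 c1)
  po_right : IsPushout (discHom r.R (Sum.elim r.rhsIn r.rhsOut))
    (discHom C (Sum.elim c1 c2)) comatch h
  h_d1 : h.onV ∘ d1 = eIn
  h_d2 : h.onV ∘ d2 = eOut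

/-- Convex rewriting step with respect to a rewriting system `Rs`. -/
def ConvexStep (Rs : Set (MARule Sg ar coar)) {n m : ℕ}
    (D : Hypergraph Sg ar coar) (dIn : Fin n → D.V) (dOut : Fin m → D.V)
    (E : Hypergraph Sg ar coar) (eIn : Fin n → E.V) (eOut : Fin m → E.V) : Prop :=
  ∃ r ∈ Rs, Nonempty (StepData r D dIn dOut E eIn eOut)

/-- A hypergraph with an (n,m)-interface. -/
structure IGraph (Sg : Type) (ar coar : Sg → ℕ) (n m : ℕ) : Type 1 where
  G : Hypergraph Sg ar coar
  iIn : Fin n → G.V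
  iOut : Fin m → G.V

def StepRel (Rs : Set (MARule Sg ar coar)) {n m : ℕ}
    (X Y : IGraph Sg ar coar n m) : Prop :=
  ConvexStep Rs X.G X.iIn X.iOut Y.G Y.iIn Y.iOut

/-- Joinability: both rewrite (in finitely many convex steps) to a common
ma-hypergraph with interface. -/
def Joinable (Rs : Set (MARule Sg ar coar)) {n m : ℕ}
    (X Y : IGraph Sg ar coar n m) : Prop :=
  ∃ W, Relation.ReflTransGen (StepRel Rs) X W ∧ Relation.ReflTransGen (StepRel Rs) Y W

/-- An ma-pre-critical pair: two convex rewriting steps from a common source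
`S ← n+m` such that the combined match `L1 + L2 → S` is epi and `S ← n+m` is an
ma-hypergraph with interface. -/
structure MAPreCriticalPair (r1 r2 : MARule Sg ar coar) {n m : ℕ}
    (S : Hypergraph Sg ar coar) (sIn : Fin n → S.V) (sOut : Fin m → S.V)
    (H1 : Hypergraph Sg ar coar) (h1In : Fin n → H1.V) (h1Out : Fin m → H1.V)
    (H2 : Hypergraph Sg ar coar) (h2In : Fin n → H2.V) (h2Out : Fin m → H2.V) :
    Type 1 where
  step1 : StepData r1 S sIn sOut H1 h1In h1Out
  step2 : StepData r2 S sIn sOut H2 h2In h2Out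
  epiV : ∀ v : S.V, (∃ x, step1.f.onV x = v) ∨ (∃ x, step2.f.onV x = v)
  epiE : ∀ e : S.E, (∃ x, step1.f.onE x = e) ∨ (∃ x, step2.f.onE x = e)

/-! ### The extended signature Σ + 𝒫 with the three formal path generators -/

abbrev ESig (Sg : Type) : Type := Sg ⊕ Fin 3

/-- Arities of Σ + 𝒫: the generators have arities 2, 1, 1. -/
def ear (ar : Sg → ℕ) : ESig Sg → ℕ :=
  Sum.elim ar (fun g => if g = (0 : Fin 3) then 2 else 1)

/-- Coarities of Σ + 𝒫: the generators have coarities 1, 2, 1. -/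
def ecoar (coar : Sg → ℕ) : ESig Sg → ℕ :=
  Sum.elim coar (fun g => if g = (1 : Fin 3) then 2 else 1)

abbrev EHypergraph (Sg : Type) (ar coar : Sg → ℕ) : Type 1 :=
  Hypergraph (ESig Sg) (ear ar) (ecoar coar)

/-- A hypergraph over Σ + 𝒫 labelled only by Σ. -/
def Pure (G : EHypergraph Sg ar coar) : Prop :=
  ∀ e : G.E, (G.label e).isLeft = true

/-- A path extension of `G` realizing the relation `R ⊆ out(G) × in(G)`:
a mono `p : G → P` whose complement consists only of extra nodes and
𝒫-labelled hyperedges, with a path in `P` from `p y` to `p x` (for `y` an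
output and `x` an input of `G`) iff `(y,x) ∈ R`. -/
def IsPathExtension {G P : EHypergraph Sg ar coar}
    (p : Hom G P) (R : G.V → G.V → Prop) : Prop :=
  IsMono p ∧ (∀ e : P.E, (¬ ∃ e₀, p.onE e₀ = e) → (P.label e).isRight = true) ∧
    ∀ y x, G.IsOutput y → G.IsInput x → (HasPath P (p.onV y) (p.onV x) ↔ R y x)

/-- A path extension (realizing its own path relation). -/
def IsPathExt {G P : EHypergraph Sg ar coar} (p : Hom G P) : Prop :=
  IsMono p ∧ ∀ e : P.E, (¬ ∃ e₀, p.onE e₀ = e) → (P.label e).isRight = true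

/-- Condition (1)-(2) of Definition of maximal path relations: `R` is the path
relation of some mono of `S` into an ma-hypergraph for which both induced
matches are convex. -/
def SatPR {r1 r2 : MARule (ESig Sg) (ear ar) (ecoar coar)} {n m : ℕ}
    {S : EHypergraph Sg ar coar} {sIn : Fin n → S.V} {sOut : Fin m → S.V}
    {H1 : EHypergraph Sg ar coar} {h1In : Fin n → H1.V} {h1Out : Fin m → H1.V}
    {H2 : EHypergraph Sg ar coar} {h2In : Fin n → H2.V} {h2Out : Fin m → H2.V}
    (cp : MAPreCriticalPair r1 r2 S sIn sOut H1 h1In h1Out H2 h2In h2Out)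
    (R : S.V → S.V → Prop) : Prop :=
  ∃ (H : EHypergraph Sg ar coar) (mh : Hom S H), IsMono mh ∧ H.IsMA ∧
    (∀ y x, R y x ↔ (S.IsOutput y ∧ S.IsInput x ∧ HasPath H (mh.onV y) (mh.onV x))) ∧
    IsConvexMatch (mh.comp cp.step1.f) ∧ IsConvexMatch (mh.comp cp.step2.f)

/-- A maximal path relation for an ma-pre-critical pair. -/
def MaxPR {r1 r2 : MARule (ESig Sg) (ear ar) (ecoar coar)} {n m : ℕ}
    {S : EHypergraph Sg ar coar} {sIn : Fin n → S.V} {sOut : Fin m → S.V}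
    {H1 : EHypergraph Sg ar coar} {h1In : Fin n → H1.V} {h1Out : Fin m → H1.V}
    {H2 : EHypergraph Sg ar coar} {h2In : Fin n → H2.V} {h2Out : Fin m → H2.V}
    (cp : MAPreCriticalPair r1 r2 S sIn sOut H1 h1In h1Out H2 h2In h2Out)
    (R : S.V → S.V → Prop) : Prop :=
  SatPR cp R ∧ ∀ R', SatPR cp R' → (∀ y x, R y x → R' y x) → ∀ y x, R' y x → R y x

/-- An ma-pre-critical pair is path joinable if for every maximal path relation
`R` there is a path extension `p` with `R_p = R` such that the branching
obtained by lifting the two rewriting steps along `p` is joinable by convex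
rewriting. -/
def PathJoinable (Rs : Set (MARule (ESig Sg) (ear ar) (ecoar coar)))
    {r1 r2 : MARule (ESig Sg) (ear ar) (ecoar coar)} {n m : ℕ}
    {S : EHypergraph Sg ar coar} {sIn : Fin n → S.V} {sOut : Fin m → S.V}
    {H1 : EHypergraph Sg ar coar} {h1In : Fin n → H1.V} {h1Out : Fin m → H1.V}
    {H2 : EHypergraph Sg ar coar} {h2In : Fin n → H2.V} {h2Out : Fin m → H2.V}
    (cp : MAPreCriticalPair r1 r2 S sIn sOut H1 h1In h1Out H2 h2In h2Out) : Prop :=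
  ∀ R, MaxPR cp R →
    ∃ (P : EHypergraph Sg ar coar) (p : Hom S P), IsPathExtension p R ∧
      ∃ (pIn : Fin n → P.V) (pOut : Fin m → P.V)
        (P1 : EHypergraph Sg ar coar) (p1In : Fin n → P1.V) (p1Out : Fin m → P1.V)
        (P2 : EHypergraph Sg ar coar) (p2In : Fin n → P2.V) (p2Out : Fin m → P2.V)
        (sd1 : StepData r1 P pIn pOut P1 p1In p1Out)
        (sd2 : StepData r2 P pIn pOut P2 p2In p2Out),
        sd1.f = p.comp cp.step1.f ∧ sd2.f = p.comp cp.step2.f ∧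
        Joinable Rs ⟨P1, p1In, p1Out⟩ ⟨P2, p2In, p2Out⟩

theorem isPathFromTo_cons {G : Hypergraph Sg ar coar} {e : G.E} {p : List G.E} {x z : G.V} :
    IsPathFromTo G (e :: p) x z ↔
      x ∈ G.src e ∧ (p = [] ∧ z ∈ G.tgt e ∨ ∃ v ∈ G.tgt e, IsPathFromTo G p v z) := by
  cases p with
  | nil => simp [IsPathFromTo, List.Chain']
  | cons f p =>
    simp only [IsPathFromTo, List.Chain', List.isChain_cons_cons, EdgeStep, List.head_cons]
    constructor
    · rintro ⟨_, ⟨⟨v, hv, hv'⟩, hc⟩, hx, hz⟩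
      exact ⟨hx, .inr ⟨v, hv, by simp, hc, hv', by simpa using hz⟩⟩
    · rintro ⟨hx, h | ⟨v, hv, _, hc, hv', hz⟩⟩
      · simp at h
      · exact ⟨by simp, ⟨⟨v, hv, hv'⟩, hc⟩, hx, by simpa using hz⟩

theorem isPathFromTo_concat {G : Hypergraph Sg ar coar} {e : G.E} {p : List G.E} {x z : G.V} :
    IsPathFromTo G (p ++ [e]) x z ↔
      z ∈ G.tgt e ∧ (p = [] ∧ x ∈ G.src e ∨ ∃ v ∈ G.src e, IsPathFromTo G p x v) := by
  induction p generalizing x with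
  | nil => simp [IsPathFromTo, List.Chain', and_comm]
  | cons f p ih =>
    rw [List.cons_append, isPathFromTo_cons]
    simp only [ih, isPathFromTo_cons]
    simp only [List.append_eq_nil_iff, List.cons_ne_nil, and_false, false_and, false_or]
    constructor
    · rintro ⟨hx, v, hv, hz, ⟨rfl, hve⟩ | ⟨w, hw, hp⟩⟩
      · exact ⟨hz, v, hve, hx, .inl ⟨rfl, hv⟩⟩
      · exact ⟨hz, w, hw, hx, .inr ⟨v, hv, hp⟩⟩
    · rintro ⟨hz, w, hw, hx, ⟨rfl, hwf⟩ | ⟨v, hv, hp⟩⟩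
      · exact ⟨hx, w, hwf, hz, .inl ⟨rfl, hw⟩⟩
      · exact ⟨hx, v, hv, hz, .inr ⟨w, hw, hp⟩⟩

theorem HasPath.cons {G : Hypergraph Sg ar coar} {e : G.E} {x v z : G.V}
    (hx : x ∈ G.src e) (hv : v ∈ G.tgt e) (h : HasPath G v z ∨ v = z) : HasPath G x z := by
  obtain ⟨p, hp⟩ | rfl := h
  · exact ⟨e :: p, isPathFromTo_cons.2 ⟨hx, .inr ⟨v, hv, hp⟩⟩⟩
  · exact ⟨[e], isPathFromTo_cons.2 ⟨hx, .inl ⟨rfl, hv⟩⟩⟩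

theorem HasPath.concat {G : Hypergraph Sg ar coar} {e : G.E} {x v z : G.V}
    (h : HasPath G x v ∨ x = v) (hv : v ∈ G.src e) (hz : z ∈ G.tgt e) : HasPath G x z := by
  obtain ⟨p, hp⟩ | rfl := h
  · exact ⟨p ++ [e], isPathFromTo_concat.2 ⟨hz, .inr ⟨v, hv, hp⟩⟩⟩
  · exact ⟨[e], isPathFromTo_cons.2 ⟨hv, .inl ⟨rfl, hz⟩⟩⟩

theorem eq_of_sum_count_le_one {α ι : Type} [Fintype ι] [DecidableEq α] {f : ι → List α} {a : α}
    (h : ∑ i, (f i).count a ≤ 1) {i j : ι} (hi : a ∈ f i) (hj : a ∈ f j) : i = j := by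
  classical
  by_contra hij
  have hle : ∑ k ∈ {i, j}, (f k).count a ≤ ∑ k, (f k).count a :=
    Finset.sum_le_sum_of_subset (Finset.subset_univ _)
  rw [Finset.sum_pair hij] at hle
  have := List.count_pos_iff.2 hi
  have := List.count_pos_iff.2 hj
  omega

theorem Hypergraph.Monogamous.eq_of_mem_src {G : Hypergraph Sg ar coar} (hG : G.Monogamous)
    {v : G.V} {e f : G.E} (he : v ∈ G.src e) (hf : v ∈ G.src f) : e = f :=
  letI := Classical.decEq G.V
  eq_of_sum_count_le_one (hG v).2 he hf

theorem Hypergraph.Monogamous.eq_of_mem_tgt {G : Hypergraph Sg ar coar} (hG : G.Monogamous)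
    {v : G.V} {e f : G.E} (he : v ∈ G.tgt e) (hf : v ∈ G.tgt f) : e = f :=
  letI := Classical.decEq G.V
  eq_of_sum_count_le_one (hG v).1 he hf

theorem Hypergraph.isOutput_iff {G : Hypergraph Sg ar coar} {v : G.V} :
    G.IsOutput v ↔ ∀ e, v ∉ G.src e := by
  simp [Hypergraph.IsOutput, Hypergraph.outDegree, List.count_eq_zero]

theorem Hypergraph.isInput_iff {G : Hypergraph Sg ar coar} {v : G.V} :
    G.IsInput v ↔ ∀ e, v ∉ G.tgt e := by
  simp [Hypergraph.IsInput, Hypergraph.inDegree, List.count_eq_zero]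

/-- A node of `G` whose outgoing hyperedge in `H` is not in the image of `G` is an output. -/
theorem Hom.isOutput_of_mem_src {G H : Hypergraph Sg ar coar} (hH : H.Monogamous) (m : Hom G H)
    {v : G.V} {e : H.E} (hv : m.onV v ∈ H.src e) (he : ¬ ∃ e₀, m.onE e₀ = e) :
    G.IsOutput v :=
  Hypergraph.isOutput_iff.2 fun e₀ h₀ =>
    he ⟨e₀, hH.eq_of_mem_src (by rw [m.src_eq]; exact List.mem_map_of_mem h₀) hv⟩

/-- A node of `G` whose incoming hyperedge in `H` is not in the image of `G` is an input. -/
theorem Hom.isInput_of_mem_tgt {G H : Hypergraph Sg ar coar} (hH : H.Monogamous) (m : Hom G H)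
    {v : G.V} {e : H.E} (hv : m.onV v ∈ H.tgt e) (he : ¬ ∃ e₀, m.onE e₀ = e) :
    G.IsInput v :=
  Hypergraph.isInput_iff.2 fun e₀ h₀ =>
    he ⟨e₀, hH.eq_of_mem_tgt (by rw [m.tgt_eq]; exact List.mem_map_of_mem h₀) hv⟩

theorem Hom.mem_src_onE {G H : Hypergraph Sg ar coar} {m : Hom G H} (hm : IsMono m)
    {v : G.V} {e : G.E} : m.onV v ∈ H.src (m.onE e) ↔ v ∈ G.src e := by
  rw [m.src_eq, List.mem_map_of_injective hm.1]

theorem Hom.mem_tgt_onE {G H : Hypergraph Sg ar coar} {m : Hom G H} (hm : IsMono m)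
    {v : G.V} {e : G.E} : m.onV v ∈ H.tgt (m.onE e) ↔ v ∈ G.tgt e := by
  rw [m.tgt_eq, List.mem_map_of_injective hm.1]

/-- A path in `H` starting in the image of `G` and using a hyperedge outside it
leaves `G` through an output. -/
theorem exists_output_of_isPathFromTo {G H : Hypergraph Sg ar coar} (hH : H.Monogamous)
    {m : Hom G H} (hm : IsMono m) {p : List H.E} {a : G.V} {z : H.V}
    (h : IsPathFromTo H p (m.onV a) z) (hout : ∃ e ∈ p, ¬ ∃ e₀, m.onE e₀ = e) :
    ∃ y', G.IsOutput y' ∧ (HasPath G a y' ∨ a = y') ∧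
      ∃ q, IsPathFromTo H q (m.onV y') z ∧ ∃ e ∈ q, ¬ ∃ e₀, m.onE e₀ = e := by
  induction p generalizing a with
  | nil => simp at hout
  | cons e p ih =>
    by_cases he : ∃ e₀, m.onE e₀ = e
    · obtain ⟨hs, h⟩ := isPathFromTo_cons.1 h
      have hout' : ∃ e ∈ p, ¬ ∃ e₀, m.onE e₀ = e := by
        obtain ⟨f, hf, hf'⟩ := hout
        obtain rfl | hf := List.mem_cons.1 hf
        · exact absurd he hf'
        · exact ⟨f, hf, hf'⟩
      obtain ⟨rfl, -⟩ | ⟨v, hv, hp⟩ := h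
      · simp at hout'
      obtain ⟨e₀, rfl⟩ := he
      rw [m.tgt_eq] at hv
      obtain ⟨b, hb, rfl⟩ := List.mem_map.1 hv
      obtain ⟨y', hy', hby', hq⟩ := ih hp hout'
      exact ⟨y', hy', .inl (.cons ((Hom.mem_src_onE hm).1 hs) hb hby'), hq⟩
    · exact ⟨a, m.isOutput_of_mem_src hH (isPathFromTo_cons.1 h).1 he, .inr rfl,
        e :: p, h, e, by simp, he⟩

/-- A path in `H` ending in the image of `G` and using a hyperedge outside it
enters `G` through an input. -/
theorem exists_input_of_isPathFromTo {G H : Hypergraph Sg ar coar} (hH : H.Monogamous)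
    {m : Hom G H} (hm : IsMono m) {p : List H.E} {a : H.V} {b : G.V}
    (h : IsPathFromTo H p a (m.onV b)) (hout : ∃ e ∈ p, ¬ ∃ e₀, m.onE e₀ = e) :
    ∃ x', G.IsInput x' ∧ (HasPath G x' b ∨ x' = b) ∧ HasPath H a (m.onV x') := by
  induction p using List.reverseRecOn generalizing b with
  | nil => simp at hout
  | append_singleton p e ih =>
    by_cases he : ∃ e₀, m.onE e₀ = e
    · obtain ⟨ht, h⟩ := isPathFromTo_concat.1 h
      have hout' : ∃ e ∈ p, ¬ ∃ e₀, m.onE e₀ = e := by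
        obtain ⟨f, hf, hf'⟩ := hout
        obtain hf | hf := List.mem_append.1 hf
        · exact ⟨f, hf, hf'⟩
        · exact absurd (List.mem_singleton.1 hf ▸ he) hf'
      obtain ⟨rfl, -⟩ | ⟨v, hv, hp⟩ := h
      · simp at hout'
      obtain ⟨e₀, rfl⟩ := he
      rw [m.src_eq] at hv
      obtain ⟨c, hc, rfl⟩ := List.mem_map.1 hv
      obtain ⟨x', hx', hxc, hq⟩ := ih hp hout'
      exact ⟨x', hx', .inl (.concat hxc hc ((Hom.mem_tgt_onE hm).1 ht)), hq⟩
    · exact ⟨b, m.isInput_of_mem_tgt hH (isPathFromTo_concat.1 h).1 he, .inr rfl, _, h⟩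

/-- a path in `H` from `m(k(y))` to `m(k(x))` using a hyperedge
outside the image of `m` decomposes through an output `y'` and an input `x'`
of `G`: a path (or equality) from `k y` to `y'` in `G`, a path in `H`
witnessing `(y',x') ∈ R_m`, and a path (or equality) from `x'` to `k x` in `G`. -/
theorem path_decomposition {Sg : Type} {ar coar : Sg → ℕ}
    {K G H : Hypergraph Sg ar coar}
    (hK : K.IsMA) (hG : G.IsMA) (hH : H.IsMA)
    (k : Hom K G) (m : Hom G H) (hk : IsMono k) (hm : IsMono m)
    (y x : K.V) (hy : K.IsOutput y) (hx : K.IsInput x)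
    (p : List H.E) (hp : p ≠ []) (hch : List.Chain' (EdgeStep H) p)
    (hs : m.onV (k.onV y) ∈ H.src (p.head hp))
    (ht : m.onV (k.onV x) ∈ H.tgt (p.getLast hp))
    (hout : ∃ e ∈ p, ¬ ∃ e₀, m.onE e₀ = e) :
    ∃ y' x', G.IsOutput y' ∧ G.IsInput x' ∧
      (HasPath G (k.onV y) y' ∨ k.onV y = y') ∧
      HasPath H (m.onV y') (m.onV x') ∧
      (HasPath G x' (k.onV x) ∨ x' = k.onV x) := by
  obtain ⟨y', hy', hyy', q, hq, hqout⟩ :=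
    exists_output_of_isPathFromTo hH.2 hm ⟨hp, hch, hs, ht⟩ hout
  obtain ⟨x', hx', hxx', hpath⟩ := exists_input_of_isPathFromTo hH.2 hm hq hqout
  exact ⟨y', x', hy', hx', hyy', hpath, hxx'⟩

end HypRw
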